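/- Let q > 3 be a prime such that p = 4q + 1 is also prime, and let D be a nontrivial difference set in the additive group ZMod p with 2·|D| < p. Then every integer t whose multiplicative order modulo p equals q is a multiplier of D, i.e., there exists g ∈ ZMod p with {t·d : d ∈ D} = {d + g : d ∈ D}. -/

import Mathlib

/-- A subset `D` of the additive group `ZMod p` is a difference set with parameter `lam`
(a positive integer) if every nonzero `g : ZMod p` has exactly `lam` representations
`g = d₂ - d₁` with `d₁, d₂ ∈ D`. -/
def IsDiffSetZMod (p : ℕ) (D : Finset (ZMod p)) (lam : ℕ) : Prop :=
  0 < lam ∧ ∀ g : ZMod p, g ≠ 0 →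
    ((D ×ˢ D).filter (fun x => x.2 - x.1 = g)).card = lam


lemma map_prime_eq {O : Type*} [CommRing O] (z : O)
    (hz : Algebra.adjoin ℤ {z} = ⊤) (σ : O ≃+* O) (r f : ℕ) (hr : r.Prime)
    (hσ : σ z = z ^ (r ^ f)) (P : Ideal O) (hP : P.IsMaximal) (hrP : (r : O) ∈ P) :
    P.map (σ : O →+* O) = P := by
  have hP' : P.IsPrime := hP.isPrime
  have : Fact r.Prime := ⟨hr⟩
  have hch : CharP (O ⧸ P) r := by
    rw [CharP.charP_iff_prime_eq_zero hr]
    have := Ideal.Quotient.eq_zero_iff_mem.2 hrP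
    simpa using this
  have key : ((Ideal.Quotient.mk P).comp (σ : O →+* O)).toIntAlgHom =
      ((iterateFrobenius (O ⧸ P) r f).comp (Ideal.Quotient.mk P)).toIntAlgHom := by
    apply AlgHom.ext_of_adjoin_eq_top hz
    intro x hx
    rw [Set.mem_singleton_iff] at hx
    subst hx
    simp [hσ, iterateFrobenius_def]
  have hle : P ≤ P.comap (σ : O →+* O) := by
    intro x hx
    rw [Ideal.mem_comap, ← Ideal.Quotient.eq_zero_iff_mem]
    have := DFunLike.congr_fun key x
    simp only [RingHom.toIntAlgHom_apply, RingHom.comp_apply] at this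
    rw [this, Ideal.Quotient.eq_zero_iff_mem.2 hx, map_zero]
  have heq : P = P.comap (σ : O →+* O) :=
    hP.eq_of_le (Ideal.comap_ne_top _ hP.ne_top) hle
  conv_lhs => rw [heq]
  exact Ideal.map_comap_of_surjective _ σ.surjective P

lemma map_ideal_eq {O : Type*} [CommRing O] [IsDedekindDomain O] (σ : O ≃+* O)
    (I : Ideal O) (hI : I ≠ 0)
    (h : ∀ P : Ideal O, P.IsMaximal → I ≤ P → P.map (σ : O →+* O) = P) :
    I.map (σ : O →+* O) = I := by
  classical
  have h1 := Ideal.prod_normalizedFactors_eq_self hI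
  have h2 : (Ideal.mapHom (σ : O →+* O)) I = I := by
    conv_lhs => rw [← h1]
    conv_rhs => rw [← h1]
    rw [map_multiset_prod]
    congr 1
    conv_rhs => rw [← Multiset.map_id (UniqueFactorizationMonoid.normalizedFactors I)]
    apply Multiset.map_congr rfl
    intro P hP
    have hpr := UniqueFactorizationMonoid.prime_of_normalized_factor P hP
    apply h P
    · exact (Ideal.isPrime_of_prime hpr).isMaximal hpr.ne_zero
    · exact Ideal.le_of_dvd (UniqueFactorizationMonoid.dvd_of_mem_normalizedFactors hP)
  exact h2

lemma fiber_zero (p : ℕ) (D : Finset (ZMod p)) :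
    ((D ×ˢ D).filter (fun x => x.2 - x.1 = 0)).card = D.card := by
  have : (D ×ˢ D).filter (fun x => x.2 - x.1 = 0) = D.image (fun d => (d, d)) := by
    ext ⟨a, b⟩
    simp only [Finset.mem_filter, Finset.mem_product, Finset.mem_image, sub_eq_zero, Prod.mk.injEq]
    constructor
    · rintro ⟨⟨h1, h2⟩, rfl⟩
      exact ⟨_, h1, rfl, rfl⟩
    · rintro ⟨d, hd, rfl, rfl⟩
      exact ⟨⟨hd, hd⟩, rfl⟩
  rw [this, Finset.card_image_of_injective]
  intro a b h
  simpa using h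

lemma count_eq (p : ℕ) [NeZero p] (D : Finset (ZMod p)) (lam : ℕ) (hD : IsDiffSetZMod p D lam) :
    D.card * D.card = D.card + lam * (p - 1) := by
  rw [← Finset.card_product, Finset.card_eq_sum_card_fiberwise (f := fun x => x.2 - x.1)
    (t := Finset.univ) (fun _ _ => Finset.mem_coe.2 (Finset.mem_univ _)),
    ← Finset.add_sum_erase _ _ (Finset.mem_univ 0), fiber_zero,
    Finset.sum_congr rfl (fun g hg => hD.2 g (Finset.ne_of_mem_erase hg))]
  simp [Finset.card_erase_of_mem, ZMod.card, mul_comm]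

lemma char_mul (p : ℕ) [NeZero p] (D : Finset (ZMod p)) (lam : ℕ) (hD : IsDiffSetZMod p D lam)
    {R : Type*} [CommRing R] [IsDomain R] (ψ : AddChar (ZMod p) R) (hψ : ψ ≠ 1) :
    (∑ d ∈ D, ψ d) * (∑ d ∈ D, ψ (-d)) = (D.card : R) - lam := by
  have h0 : ∑ g ∈ Finset.univ.erase (0 : ZMod p), ψ g = -1 := by
    have h := AddChar.sum_eq_zero_of_ne_one hψ
    rw [← Finset.add_sum_erase _ _ (Finset.mem_univ 0), AddChar.map_zero_eq_one] at h
    linear_combination h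
  rw [mul_comm, Finset.sum_mul_sum, ← Finset.sum_product',
    ← Finset.sum_fiberwise (s := D ×ˢ D) (g := fun x => x.2 - x.1),
    ← Finset.add_sum_erase _ _ (Finset.mem_univ 0)]
  have h1 : ∀ g : ZMod p, ∑ x ∈ (D ×ˢ D).filter (fun x => x.2 - x.1 = g), ψ (-x.1) * ψ x.2 =
      ((D ×ˢ D).filter (fun x => x.2 - x.1 = g)).card * ψ g := by
    intro g
    rw [← nsmul_eq_mul]
    apply Finset.sum_eq_card_nsmul
    intro x hx
    rw [← (Finset.mem_filter.1 hx).2, ← AddChar.map_add_eq_mul]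
    congr 1; ring
  have h2 : ∑ g ∈ Finset.univ.erase (0 : ZMod p),
      ∑ x ∈ (D ×ˢ D).filter (fun x => x.2 - x.1 = g), ψ (-x.1) * ψ x.2 = lam * -1 := by
    rw [← h0, Finset.mul_sum]
    apply Finset.sum_congr rfl
    intro g hg
    rw [h1, hD.2 g (Finset.ne_of_mem_erase hg)]
  rw [h2, h1, fiber_zero, AddChar.map_zero_eq_one]
  ring

open Polynomial in
lemma lin_indep (p : ℕ) (hp : p.Prime) [NeZero p] {K : Type*} [Field K] [CharZero K] (ζ : K)
    (hζ : IsPrimitiveRoot ζ p) (c : ZMod p → ℤ) (h : ∑ a, (c a : K) * ζ ^ a.val = 0) (a b : ZMod p) :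
    c a = c b := by
  have : Fact p.Prime := ⟨hp⟩
  set F : ℤ[X] := ∑ a : ZMod p, C (c a) * X ^ a.val with hF
  have hcoef : ∀ a : ZMod p, F.coeff a.val = c a := by
    intro a
    rw [hF, finsetSum_coeff, Finset.sum_eq_single a]
    · simp
    · intro b _ hb
      rw [coeff_C_mul_X_pow, if_neg]
      intro h
      exact hb (ZMod.val_injective p h.symm)
    · simp
  have hdvd : cyclotomic p ℤ ∣ F := by
    rw [cyclotomic_eq_minpoly hζ hp.pos]
    apply minpoly.isIntegrallyClosed_dvd (hζ.isIntegral hp.pos)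
    rw [hF, map_sum, ← h]
    simp
  obtain ⟨G, hG⟩ := hdvd
  have hdeg : F.natDegree ≤ p - 1 := by
    apply natDegree_sum_le_of_forall_le
    intro a _
    refine (natDegree_C_mul_X_pow_le _ _).trans ?_
    have := ZMod.val_lt a
    omega
  have hGdeg : G.natDegree = 0 := by
    by_cases h0 : G = 0
    · simp [h0]
    have : F.natDegree = (p - 1) + G.natDegree := by
      rw [hG, natDegree_mul (cyclotomic_ne_zero _ _) h0, natDegree_cyclotomic,
        Nat.totient_prime hp]
    omega
  rw [eq_C_of_natDegree_eq_zero hGdeg, cyclotomic_prime] at hG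
  have : ∀ a : ZMod p, c a = G.coeff 0 := by
    intro a
    rw [← hcoef, hG, coeff_mul_C, finsetSum_coeff]
    simp [coeff_X_pow, ZMod.val_lt a]
  rw [this a, this b]
lemma k_cases (q p k lam : ℕ) (hq : q.Prime) (hq3 : 3 < q)
    (hpdef : p = 4 * q + 1) (hk : k * k = k + lam * (p - 1)) (hk2 : 2 ≤ k) (hkp : 2 * k < p) :
    (k = q ∧ q = 4 * lam + 1) ∨ (k = q + 1 ∧ q + 1 = 4 * lam) := by
  obtain ⟨j, rfl⟩ : ∃ j, k = j + 1 := ⟨k - 1, by omega⟩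
  have h1 : (j + 1) * j = lam * (4 * q) := by
    have : p - 1 = 4 * q := by omega
    rw [this] at hk
    nlinarith
  have hd : q ∣ (j + 1) * j := ⟨lam * 4, by rw [h1]; ring⟩
  rcases (hq.dvd_mul).1 hd with ⟨m, hm⟩ | ⟨m, hm⟩
  · have : m < 3 := by
      by_contra h
      have : q * 3 ≤ q * m := Nat.mul_le_mul_left _ (by omega)
      omega
    interval_cases m
    · omega
    · left
      have : j = 4 * lam := by
        apply Nat.eq_of_mul_eq_mul_left (show 0 < q by omega)
        nlinarith
      omega
    · exfalso
      have : j * 2 = 4 * lam := by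
        apply Nat.eq_of_mul_eq_mul_left (show 0 < q by omega)
        nlinarith
      omega
  · have : m < 2 := by
      by_contra h
      have : q * 2 ≤ q * m := Nat.mul_le_mul_left _ (by omega)
      omega
    interval_cases m
    · omega
    · right
      have : j + 1 = 4 * lam := by
        apply Nat.eq_of_mul_eq_mul_left (show 0 < q by omega)
        nlinarith
      omega

lemma no_sq (q p k lam r : ℕ) (hq : q.Prime) (hq3 : 3 < q)
    (hpdef : p = 4 * q + 1) (hp : p.Prime)
    (hc : (k = q ∧ q = 4 * lam + 1) ∨ (k = q + 1 ∧ q + 1 = 4 * lam))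
    (hr : r.Prime) (hrn : r ∣ k - lam) : ¬ p ∣ r ^ 2 + 1 := by
  intro hd
  have hr2 := hr.two_le
  rcases hc with ⟨h1, h2⟩ | ⟨h1, h2⟩
  · obtain ⟨s, hs⟩ := hrn
    have hn : 16 * (r * s) = 3 * p + 1 := by omega
    have hl : 3 ≤ lam := by
      by_contra h
      have : lam < 3 := by omega
      interval_cases lam
      · omega
      · subst h2; norm_num at hpdef; subst hpdef; norm_num at hp
      · subst h2; norm_num at hq
    have hs1 : 1 ≤ s := by
      rcases Nat.eq_zero_or_pos s with h | h
      · subst h; omega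
      · exact h
    have hd2 : p ∣ r + 16 * s := by
      have e : 16 * s * (r ^ 2 + 1) = p * (3 * r) + (r + 16 * s) := by
        calc 16 * s * (r ^ 2 + 1) = r * (16 * (r * s)) + 16 * s := by ring
          _ = _ := by rw [hn]; ring
      exact (Nat.dvd_add_right (Dvd.intro _ rfl)).1 (e ▸ hd.mul_left _)
    obtain ⟨m, hm⟩ := hd2
    have hb : 16 * (r + 2 * s) ≤ 3 * p + 33 := by
      obtain ⟨a, rfl⟩ := Nat.exists_eq_add_of_le hr2
      obtain ⟨b, rfl⟩ := Nat.exists_eq_add_of_le hs1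
      nlinarith [Nat.zero_le (a * b)]
    have hm2 : m < 2 := by
      by_contra h
      have : p * 2 ≤ p * m := Nat.mul_le_mul_left _ (by omega)
      omega
    interval_cases m
    · omega
    · have e : p * r = r ^ 2 + 3 * p + 1 := by nlinarith
      have hr4 : 3 < r := by
        by_contra h
        have : p * r ≤ p * 3 := Nat.mul_le_mul_left _ (by omega)
        have := Nat.zero_le (r ^ 2)
        omega
      obtain ⟨a, rfl⟩ := Nat.exists_eq_add_of_lt hr4
      have e2 : (a + 1) * p = (a + 1) * (a + 7) + 10 := by nlinarith
      have : a + 1 ∣ 10 := (Nat.dvd_add_right (Dvd.intro _ rfl)).1 (e2 ▸ Dvd.intro _ rfl)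
      have := Nat.le_of_dvd (by norm_num) this
      have : a < 10 := by omega
      interval_cases a <;> omega
  · have hn : k - lam = 3 * lam := by omega
    rw [hn] at hrn
    have hl : 2 ≤ lam := by omega
    rcases (hr.dvd_mul).1 hrn with h3 | ⟨s, hs⟩
    · have : r = 3 := (Nat.prime_dvd_prime_iff_eq hr Nat.prime_three).1 h3
      subst this
      have := Nat.le_of_dvd (by norm_num) hd
      omega
    · have hn : 16 * (r * s) = p + 3 := by omega
      have hs1 : 1 ≤ s := by
        rcases Nat.eq_zero_or_pos s with h | h
        · subst h; omega
        · exact h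
      have hd2 : p ∣ 3 * r + 16 * s := by
        have e : 16 * s * (r ^ 2 + 1) = p * r + (3 * r + 16 * s) := by
          calc 16 * s * (r ^ 2 + 1) = r * (16 * (r * s)) + 16 * s := by ring
            _ = _ := by rw [hn]; ring
        exact (Nat.dvd_add_right (Dvd.intro _ rfl)).1 (e ▸ hd.mul_left _)
      have hle := Nat.le_of_dvd (by omega) hd2
      have hb : 16 * (r + 2 * s) ≤ p + 35 := by
        obtain ⟨a, rfl⟩ := Nat.exists_eq_add_of_le hr2
        obtain ⟨b, rfl⟩ := Nat.exists_eq_add_of_le hs1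
        nlinarith [Nat.zero_le (a * b)]
      omega

lemma pow_four (q p k lam r : ℕ) (hq : q.Prime) (hq3 : 3 < q)
    (hpdef : p = 4 * q + 1) (hp : p.Prime)
    (hc : (k = q ∧ q = 4 * lam + 1) ∨ (k = q + 1 ∧ q + 1 = 4 * lam))
    (hr : r.Prime) (hrn : r ∣ k - lam) : (r : ZMod p) ^ 4 ≠ 1 := by
  intro h
  have := Fact.mk hp
  have hr2 := hr.two_le
  have hle := Nat.le_of_dvd (by omega) hrn
  have h' : ((r - 1 : ZMod p)) * ((r + 1) * (r ^ 2 + 1)) = 0 := by linear_combination h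
  rcases mul_eq_zero.1 h' with h' | h'
  · have : ((r - 1 : ℕ) : ZMod p) = 0 := by rw [Nat.cast_sub (by omega)]; simpa using h'
    have := Nat.le_of_dvd (by omega) ((ZMod.natCast_eq_zero_iff _ _).1 this)
    omega
  rcases mul_eq_zero.1 h' with h' | h'
  · have : ((r + 1 : ℕ) : ZMod p) = 0 := by simpa using h'
    have := Nat.le_of_dvd (by omega) ((ZMod.natCast_eq_zero_iff _ _).1 this)
    omega
  · have : ((r ^ 2 + 1 : ℕ) : ZMod p) = 0 := by simpa using h'
    exact no_sq q p k lam r hq hq3 hpdef hp hc hr hrn ((ZMod.natCast_eq_zero_iff _ _).1 this)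

lemma pow_eq_t (q p : ℕ) (hq : q.Prime) (hpdef : p = 4 * q + 1) (hp : p.Prime)
    (r t : ZMod p) (hr0 : r ≠ 0) (hr : r ^ 4 ≠ 1) (ht : orderOf t = q) : ∃ f : ℕ, t = r ^ f := by
  have := Fact.mk hp
  have h1 : (r ^ 4) ^ q = 1 := by
    rw [← pow_mul, show 4 * q = p - 1 by omega]
    exact ZMod.pow_card_sub_one_eq_one hr0
  have := Fact.mk hq
  have ho : orderOf (r ^ 4) = q := orderOf_eq_prime h1 hr
  have hprim : IsPrimitiveRoot (r ^ 4) q := ho ▸ IsPrimitiveRoot.orderOf (r ^ 4)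
  have htq : t ^ q = 1 := ht ▸ pow_orderOf_eq_one t
  have : NeZero q := ⟨hq.ne_zero⟩
  obtain ⟨i, _, hi⟩ := hprim.eq_pow_of_pow_eq_one htq
  exact ⟨4 * i, by rw [← hi, pow_mul]⟩

lemma norm_sq (p : ℕ) [NeZero p] (D : Finset (ZMod p)) (lam : ℕ) (hD : IsDiffSetZMod p D lam)
    (χ : AddChar (ZMod p) ℂ) (hχ : χ ≠ 1) : ‖∑ d ∈ D, χ d‖ ^ 2 = (D.card : ℝ) - lam := by
  have h := char_mul p D lam hD χ hχ
  have h2 : ∑ d ∈ D, χ (-d) = (starRingEnd ℂ) (∑ d ∈ D, χ d) := by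
    rw [map_sum]
    exact Finset.sum_congr rfl fun d _ => AddChar.map_neg_eq_conj χ d
  rw [h2, Complex.mul_conj, Complex.normSq_eq_norm_sq] at h
  exact_mod_cast h

lemma sets_eq (p : ℕ) (hp : p.Prime) [NeZero p] {K : Type*} [Field K] [CharZero K] (ζ : K)
    (hζ : IsPrimitiveRoot ζ p) (A B : Finset (ZMod p)) (hAB : A.card = B.card)
    (h0 : 0 < A.card) (h1 : 2 * A.card < p) (s : ℤ) (hs : s = 1 ∨ s = -1)
    (h : ∑ a ∈ A, ζ ^ a.val = s * ∑ a ∈ B, ζ ^ a.val) : A = B := by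
  set c : ZMod p → ℤ := fun a => (if a ∈ A then 1 else 0) - s * (if a ∈ B then 1 else 0) with hc
  have hsum : ∑ a, (c a : K) * ζ ^ a.val = 0 := by
    rw [← sub_eq_zero] at h
    rw [← h, Finset.mul_sum]
    simp [hc, sub_mul, Finset.sum_sub_distrib, ite_mul]
  have hconst := lin_indep p hp ζ hζ c hsum
  have htot : ∑ a, c a = A.card - s * B.card := by
    simp [hc, Finset.sum_sub_distrib, mul_comm]
  have htot2 : ∑ a, c a = p * c 0 := by
    rw [Finset.sum_congr rfl (fun a _ => hconst a 0)]
    simp [ZMod.card]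
  rw [htot2, ← hAB] at htot
  rcases hs with rfl | rfl
  · have h00 : c 0 = 0 := by
      have : (p : ℤ) * c 0 = 0 := by rw [htot]; ring
      rcases mul_eq_zero.1 this with h | h
      · exact absurd h (by exact_mod_cast hp.ne_zero)
      · exact h
    ext a
    have := (hconst a 0).trans h00
    simp only [hc] at this
    by_cases ha : a ∈ A <;> by_cases hb : a ∈ B <;> simp [ha, hb] at this ⊢
  · exfalso
    have h2 : (p : ℤ) * c 0 = 2 * A.card := by rw [htot]; ring
    have h3 : p ∣ 2 * A.card := by
      have : (p : ℤ) ∣ ((2 * A.card : ℕ) : ℤ) := ⟨c 0, by push_cast; exact h2.symm⟩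
      exact_mod_cast this
    have := Nat.le_of_dvd (by omega) h3
    omega

open NumberField in
lemma multiplier_core (p : ℕ) [NeZero p] (hp : p.Prime) (hp2 : p ≠ 2)
    (K : Type) [Field K] [NumberField K] [IsCyclotomicExtension {p} ℚ K]
    (D : Finset (ZMod p)) (lam : ℕ) (hD : IsDiffSetZMod p D lam)
    (hk0 : 0 < D.card) (hsmall : 2 * D.card < p) (hlam : lam < D.card)
    (t : ZMod p) (ht : t ≠ 0)
    (hpow : ∀ r : ℕ, r.Prime → r ∣ D.card - lam → ∃ f : ℕ, t = (r : ZMod p) ^ f) :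
    ∃ g : ZMod p, D.image (fun d => t * d) = D.image (fun d => d + g) := by
  have : Fact p.Prime := ⟨hp⟩
  set ζ : K := IsCyclotomicExtension.zeta p ℚ K with hζdef
  have hζ : IsPrimitiveRoot ζ p := IsCyclotomicExtension.zeta_spec p ℚ K
  set z : 𝓞 K := hζ.toInteger with hzdef
  have hz : IsPrimitiveRoot z p := hζ.toInteger_isPrimitiveRoot
  have hzK : (z : K) = ζ := rfl
  have hadj : Algebra.adjoin ℤ {z} = ⊤ := IsCyclotomicExtension.Rat.adjoin_singleton_eq_top hζ
  have hcop : t.val.Coprime p := by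
    rw [Nat.coprime_comm, hp.coprime_iff_not_dvd]
    intro h
    have h0 : 0 < t.val := Nat.pos_of_ne_zero (by simpa using ht)
    have := Nat.le_of_dvd h0 h
    have := ZMod.val_lt t
    omega
  have hμ : IsPrimitiveRoot (ζ ^ t.val) p := hζ.pow_of_coprime _ hcop
  let σK : K ≃ₐ[ℚ] K := IsCyclotomicExtension.fromZetaAut hμ
    (Polynomial.cyclotomic.irreducible_rat hp.pos)
  have hσK : σK ζ = ζ ^ t.val := IsCyclotomicExtension.fromZetaAut_spec hμ _
  let σ : 𝓞 K ≃+* 𝓞 K := RingOfIntegers.mapRingEquiv σK.toRingEquiv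
  have hσ : σ z = z ^ t.val := by
    apply RingOfIntegers.ext
    exact hσK
  let ψ : AddChar (ZMod p) (𝓞 K) := AddChar.zmodChar p hz.pow_eq_one
  have hψa : ∀ a, ψ a = z ^ a.val := fun a => rfl
  have hψnat : ∀ a : ℕ, ψ a = z ^ a := fun a => AddChar.zmodChar_apply' hz.pow_eq_one a
  have hψ1 : ψ 1 = z := by simpa using hψnat 1
  have hz1 : z ≠ 1 := hz.ne_one hp.one_lt
  have hψne : ψ ≠ 1 := fun h => hz1 (by rw [← hψ1, h]; rfl)
  have hσψ : ∀ a, σ (ψ a) = ψ (t * a) := by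
    intro a
    rw [hψa, map_pow, hσ, ← pow_mul, ← hψnat]
    congr 1
    simp
  set S : 𝓞 K := ∑ d ∈ D, ψ d with hS
  have hmul := char_mul p D lam hD ψ hψne
  have hnn : ((D.card - lam : ℕ) : 𝓞 K) = (D.card : 𝓞 K) - lam := Nat.cast_sub hlam.le
  rw [← hS, ← hnn] at hmul
  have hn0 : ((D.card - lam : ℕ) : 𝓞 K) ≠ 0 := by
    exact_mod_cast (show D.card - lam ≠ 0 by omega)
  have hS0 : S ≠ 0 := by
    intro h
    rw [h, zero_mul] at hmul
    exact hn0 hmul.symm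
  -- the ideal generated by S is fixed
  have hI : (Ideal.span {S}).map (σ : 𝓞 K →+* 𝓞 K) = Ideal.span {S} := by
    apply map_ideal_eq
    · simpa using hS0
    · intro P hP hle
      have hSP : S ∈ P := hle (Ideal.mem_span_singleton_self S)
      have hnP : ((D.card - lam : ℕ) : 𝓞 K) ∈ P := hmul ▸ P.mul_mem_right _ hSP
      have hP' : P.IsPrime := hP.isPrime
      have hex : ∃ r : ℕ, r.Prime ∧ r ∣ D.card - lam ∧ (r : 𝓞 K) ∈ P := by
        have h1 := Nat.prod_primeFactorsList (show D.card - lam ≠ 0 by omega)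
        rw [← h1, Nat.cast_list_prod, ← Multiset.prod_coe, hP'.multiset_prod_mem_iff_exists_mem]
          at hnP
        obtain ⟨x, hx, hxP⟩ := hnP
        simp only [Multiset.mem_coe, List.mem_map] at hx
        obtain ⟨r, hr, rfl⟩ := hx
        exact ⟨r, Nat.prime_of_mem_primeFactorsList hr, Nat.dvd_of_mem_primeFactorsList hr, hxP⟩
      obtain ⟨r, hr, hrn, hrP⟩ := hex
      obtain ⟨f, hf⟩ := hpow r hr hrn
      apply map_prime_eq z hadj σ r f hr _ P hP hrP
      rw [hσ, ← hψnat, ← hψnat]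
      congr 1
      simp [hf]
  rw [Ideal.map_span, Set.image_singleton, Ideal.span_singleton_eq_span_singleton] at hI
  obtain ⟨u, hu⟩ := hI.symm
  replace hu : S * u = σ S := hu
  -- u has absolute value one everywhere
  have hnorm : ∀ φ : K →+* ℂ, ‖φ ((u : 𝓞 K) : K)‖ = 1 := by
    intro φ
    let φ1 : 𝓞 K →+* ℂ := φ.comp (algebraMap (𝓞 K) K)
    have hinj : Function.Injective φ1 := φ.injective.comp RingOfIntegers.coe_injective
    let φ2 : 𝓞 K →+* ℂ := φ1.comp (σ : 𝓞 K →+* 𝓞 K)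
    have hinj2 : Function.Injective φ2 := hinj.comp σ.injective
    have aux : ∀ φ' : 𝓞 K →+* ℂ, Function.Injective φ' → ‖φ' S‖ ^ 2 = (D.card : ℝ) - lam := by
      intro φ' hφ'
      have := norm_sq p D lam hD ((φ' : 𝓞 K →* ℂ).compAddChar ψ) (by
        intro h
        apply hz1
        apply hφ'
        have := DFunLike.congr_fun h 1
        simpa [hψ1] using this)
      rw [← this, hS, map_sum]
      rfl
    have e1 := aux φ1 hinj
    have e2 := aux φ2 hinj2
    have e3 : φ2 S = φ1 S * φ1 u := by
      change φ1 (σ S) = _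
      rw [← hu, map_mul]
    rw [e3, norm_mul, mul_pow, e1] at e2
    have hpos : (0 : ℝ) < (D.card : ℝ) - lam := by
      rw [sub_pos]; exact_mod_cast hlam
    have e4 : ‖φ1 u‖ ^ 2 = 1 := by
      apply mul_left_cancel₀ hpos.ne'
      rw [e2, mul_one]
    exact (pow_eq_one_iff_of_nonneg (norm_nonneg _) two_ne_zero).1 e4
  obtain ⟨m, hm, hum⟩ := NumberField.Embeddings.pow_eq_one_of_norm_eq_one K ℂ
    (RingOfIntegers.isIntegral_coe (u : 𝓞 K)) hnorm
  obtain ⟨j, hj⟩ := hζ.exists_neg_pow_of_isOfFinOrder (hp.odd_of_ne_two hp2)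
    (isOfFinOrder_iff_pow_eq_one.2 ⟨m, hm, hum⟩)
  refine ⟨(j : ZMod p), ?_⟩
  have hi1 : Function.Injective (fun d : ZMod p => t * d) := mul_right_injective₀ ht
  have hi2 : Function.Injective (fun d : ZMod p => d + j) := add_left_injective _
  have hc1 := Finset.card_image_of_injective D hi1
  have hc2 := Finset.card_image_of_injective D hi2
  refine sets_eq p hp ζ hζ _ _ (hc1.trans hc2.symm) (by omega) (by omega) ((-1) ^ j)
    (neg_one_pow_eq_or ℤ j) ?_
  rw [Finset.sum_image hi1.injOn, Finset.sum_image hi2.injOn]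
  have hψK : ∀ a, ζ ^ a.val = (ψ a : K) := fun a => by rw [hψa]; rfl
  have hfin : σ S = ∑ d ∈ D, ψ (t * d) := by
    rw [hS, map_sum]
    exact Finset.sum_congr rfl fun d _ => hσψ d
  have hfin2 : (u : 𝓞 K) = (-1) ^ j * ψ j := by
    apply RingOfIntegers.ext
    refine hj.trans ?_
    rw [hψnat, neg_pow]
    simp [hzK]
  rw [hfin2, hfin] at hu
  have hO : ∑ d ∈ D, ψ (t * d) = (-1) ^ j * ∑ d ∈ D, ψ (d + j) := by
    rw [← hu, hS, Finset.sum_mul, Finset.mul_sum]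
    apply Finset.sum_congr rfl
    intro d _
    rw [AddChar.map_add_eq_mul]; ring
  have hO' := congrArg (algebraMap (𝓞 K) K) hO
  simp only [map_sum, map_mul, map_pow, map_neg, map_one] at hO'
  simp only [hψK]
  push_cast
  exact hO'

theorem multiplier_of_order_q (q p : ℕ) (hq : q.Prime) (hq3 : 3 < q)
    (hpdef : p = 4 * q + 1) (hp : p.Prime)
    (D : Finset (ZMod p)) (lam : ℕ) (hD : IsDiffSetZMod p D lam)
    (hnt1 : 2 ≤ D.card) (hnt2 : D.card ≤ p - 2) (hsmall : 2 * D.card < p)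
    (t : ℤ) (ht : orderOf (t : ZMod p) = q) :
    ∃ g : ZMod p, D.image (fun d => (t : ZMod p) * d) = D.image (fun d => d + g) := by
  have : NeZero p := ⟨hp.ne_zero⟩
  have : Fact p.Prime := ⟨hp⟩
  have hc := k_cases q p D.card lam hq hq3 hpdef (count_eq p D lam hD) hnt1 hsmall
  have hlam : lam < D.card := by omega
  have hcyc : IsCyclotomicExtension {p} ℚ (CyclotomicField p ℚ) := by
    convert! CyclotomicField.isCyclotomicExtension p ℚ
  apply multiplier_core p hp (by omega) (CyclotomicField p ℚ) D lam hD (by omega) hsmall hlam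
  · intro h
    rw [h] at ht
    have := pow_orderOf_eq_one (0 : ZMod p)
    rw [ht, zero_pow hq.ne_zero] at this
    exact zero_ne_one this
  · intro r hr hrn
    refine pow_eq_t q p hq hpdef hp _ _ ?_ (pow_four q p D.card lam r hq hq3 hpdef hp hc hr hrn) ht
    intro h
    have h1 := Nat.le_of_dvd hr.pos ((ZMod.natCast_eq_zero_iff _ _).1 h)
    have h2 := Nat.le_of_dvd (by omega) hrn
    omega
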